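/- In the setting of the preceding construction (u_j univariate utilities with u_j(0)=0 satisfying the Inada conditions, U(x) = ∑_j u_j(x^j) + Λ(x), Φ̂(x) = ∑_j(−u_j(−x^j))), suppose additionally Λ(x) = ∑_{k=1}^K Λ^k(∑_{j=1}^N β^k_j x^j) with coefficients β^k_j ≥ 0, max_{j,k} β^k_j > 0, where each Λ^k : ℝ → ℝ is bounded from above, concave and increasing (not necessarily strictly), and suppose u_j ⪯ Λ^k for all j,k (i.e. there exist constants κ ∈ ℝ, c ≥ 0, C ≥ 0 with Λ^k(x) ≥ C u_j(cx) + κ for all x ≤ 0). Then L^Φ = L^{Φ̂} for Φ(x) := U(0) − U(−x), so that Standing Assumption I holds (U is a well controlled multivariate utility function with L^{Φ̂} = L^Φ). -/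

import Mathlib

open MeasureTheory Filter
open scoped BigOperators ENNReal Classical

noncomputable section

namespace MSORTE

variable {Ω : Type*} [MeasurableSpace Ω]

/-- inner product on `ℝ^N` -/
def dot {N : ℕ} (x y : Fin N → ℝ) : ℝ := ∑ j, x j * y j

/-- convex conjugate `V(y) = sup_x (U(x) - ⟨x,y⟩)` -/
def conj {N : ℕ} (U : (Fin N → ℝ) → ℝ) (y : Fin N → ℝ) : ℝ :=
  sSup {r | ∃ x : Fin N → ℝ, r = U x - dot x y}

/-- componentwise negative part -/
def negPart {N : ℕ} (x : Fin N → ℝ) : Fin N → ℝ := fun j => max (-(x j)) 0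

/-- componentwise positive part -/
def posPart {N : ℕ} (x : Fin N → ℝ) : Fin N → ℝ := fun j => max (x j) 0

/-- multivariate utility function: strictly concave, strictly increasing componentwise -/
def MultiUtility {N : ℕ} (U : (Fin N → ℝ) → ℝ) : Prop :=
  StrictConcaveOn ℝ Set.univ U ∧ ∀ x y : Fin N → ℝ, x ≤ y → x ≠ y → U x < U y

/-- multivariate Orlicz function -/
def MultiOrlicz {N : ℕ} (Φ : (Fin N → ℝ) → ℝ) : Prop :=
  Φ 0 = 0 ∧ ConvexOn ℝ {x : Fin N → ℝ | 0 ≤ x} Φ ∧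
  ContinuousOn Φ {x : Fin N → ℝ | 0 ≤ x} ∧
  (∀ x y : Fin N → ℝ, 0 ≤ x → x ≤ y → Φ x ≤ Φ y) ∧
  ∃ A > (0:ℝ), ∃ B : ℝ, ∀ x : Fin N → ℝ, 0 ≤ x → A * (∑ j, x j) - B ≤ Φ x

/-- the Orlicz function associated to a multivariate utility: `Φ(x) = U(0) - U(-x)` -/
def UPhi {N : ℕ} (U : (Fin N → ℝ) → ℝ) : (Fin N → ℝ) → ℝ := fun x => U 0 - U (-x)

/-- `U` is well controlled by the multivariate Orlicz function `Φhat` and the function `f` -/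
def WellControlledBy {N : ℕ} (U Φhat : (Fin N → ℝ) → ℝ) (f : ℝ → ℝ) : Prop :=
  MultiOrlicz Φhat ∧
  ∀ ε > (0:ℝ), ∀ x : Fin N → ℝ,
    U x ≤ -Φhat (negPart x) + ε * (∑ j, |x j|) + f ε

/-- the multivariate Orlicz space `L^Φ` -/
def Lspace {N : ℕ} (ℙ : Measure Ω) (Φ : (Fin N → ℝ) → ℝ) : Set (Ω → Fin N → ℝ) :=
  {X | Measurable X ∧ ∃ lam > (0:ℝ), Integrable (fun ω => Φ (fun j => lam * |X ω j|)) ℙ}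

/-- the multivariate Orlicz heart `M^Φ` -/
def Mspace {N : ℕ} (ℙ : Measure Ω) (Φ : (Fin N → ℝ) → ℝ) : Set (Ω → Fin N → ℝ) :=
  {X | Measurable X ∧ ∀ lam > (0:ℝ), Integrable (fun ω => Φ (fun j => lam * |X ω j|)) ℙ}

/-- the Köthe dual `K_Φ` of `L^Φ` -/
def Kdual {N : ℕ} (ℙ : Measure Ω) (Φ : (Fin N → ℝ) → ℝ) : Set (Ω → Fin N → ℝ) :=
  {Z | Measurable Z ∧ ∀ X ∈ Lspace ℙ Φ, Integrable (fun ω => ∑ j, X ω j * Z ω j) ℙ}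

/-- `C_ℝ`: random vectors whose componentwise sum is a.s. a real constant -/
def CReal {N : ℕ} (ℙ : Measure Ω) : Set (Ω → Fin N → ℝ) :=
  {Y | Measurable Y ∧ ∃ c : ℝ, ∀ᵐ ω ∂ℙ, (∑ j, Y ω j) = c}

/-- Standing Assumption II on the feasible set `𝓑` (except `X ∈ M^Φ`) -/
structure IsFeasibleSet {N : ℕ} (ℙ : Measure Ω) (B : Set (Ω → Fin N → ℝ)) : Prop where
  subset_CReal : B ⊆ CReal ℙ
  zero_mem : (0 : Ω → Fin N → ℝ) ∈ B
  add_mem : ∀ Y ∈ B, ∀ Z ∈ B, Y + Z ∈ B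
  smul_mem : ∀ Y ∈ B, ∀ c : ℝ, 0 ≤ c → c • Y ∈ B
  closed_in_probability : ∀ (Ys : ℕ → Ω → Fin N → ℝ) (Y : Ω → Fin N → ℝ),
    (∀ n, Ys n ∈ B) → Measurable Y → TendstoInMeasure ℙ Ys atTop Y → Y ∈ B
  const_add_mem : ∀ Y ∈ B, ∀ a : Fin N → ℝ, (fun ω => a + Y ω) ∈ B

/-- `𝓑_A` -/
def BA {N : ℕ} (ℙ : Measure Ω) (B : Set (Ω → Fin N → ℝ)) (A : ℝ) : Set (Ω → Fin N → ℝ) :=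
  {Y | Y ∈ B ∧ ∀ᵐ ω ∂ℙ, (∑ j, Y ω j) ≤ A}

/-- vector of Radon-Nikodym densities of a vector of measures w.r.t. `ℙ` -/
def dens {N : ℕ} (ℙ : Measure Ω) (Q : Fin N → Measure Ω) : Ω → Fin N → ℝ :=
  fun ω j => ((Q j).rnDeriv ℙ ω).toReal

/-- the set `𝓠` of admissible vectors of probability measures -/
def QSet {N : ℕ} (ℙ : Measure Ω) (B : Set (Ω → Fin N → ℝ)) (Φ : (Fin N → ℝ) → ℝ) :
    Set (Fin N → Measure Ω) :=
  {Q | (∀ j, IsProbabilityMeasure (Q j)) ∧ (∀ j, Q j ≪ ℙ) ∧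
    dens ℙ Q ∈ Kdual ℙ Φ ∧
    ∀ Y ∈ BA ℙ B 0 ∩ Mspace ℙ Φ, (∑ j, ∫ ω, Y ω j ∂(Q j)) ≤ 0}

/-- the set `𝓠_{𝓑,V}` of vectors of probability measures with finite entropy -/
def QBV {N : ℕ} (ℙ : Measure Ω) (B : Set (Ω → Fin N → ℝ))
    (Φ V : (Fin N → ℝ) → ℝ) : Set (Fin N → Measure Ω) :=
  {Q | Q ∈ QSet ℙ B Φ ∧ ∃ lam > (0:ℝ),
    Integrable (fun ω => V (fun j => lam * dens ℙ Q ω j)) ℙ}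

/-- the set `𝓛 = ⋂_{Q ∈ 𝓠_{𝓑,V}} L¹(Q)` -/
def LSet {N : ℕ} (ℙ : Measure Ω) (B : Set (Ω → Fin N → ℝ))
    (Φ V : (Fin N → ℝ) → ℝ) : Set (Ω → Fin N → ℝ) :=
  {Y | Measurable Y ∧ ∀ Q ∈ QBV ℙ B Φ V, ∀ j, Integrable (fun ω => Y ω j) (Q j)}

/-- Assumption A1: `𝓑` is closed under truncation -/
def ClosedUnderTruncation {N : ℕ} (ℙ : Measure Ω) (B : Set (Ω → Fin N → ℝ)) : Prop :=
  ∀ Y ∈ B, ∃ (mY : ℕ) (cY : Fin N → ℝ),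
    (∀ᵐ ω ∂ℙ, (∑ j, Y ω j) = ∑ j, cY j) ∧
    ∀ m : ℕ, mY ≤ m →
      (fun ω => if ∀ j, |Y ω j| < (m:ℝ) then Y ω else cY) ∈ B

/-- expected utility `E_ℙ[U(W)]` -/
def expU {N : ℕ} (ℙ : Measure Ω) (U : (Fin N → ℝ) → ℝ) (W : Ω → Fin N → ℝ) : ℝ :=
  ∫ ω, U (W ω) ∂ℙ

/-- the dual objective `λ(∑ⱼ E_{Qʲ}[Xʲ] + A) + E_ℙ[V(λ dQ/dℙ)]` -/
def dualVal {N : ℕ} (ℙ : Measure Ω) (V : (Fin N → ℝ) → ℝ) (X : Ω → Fin N → ℝ)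
    (A : ℝ) (Q : Fin N → Measure Ω) (lam : ℝ) : ℝ :=
  lam * ((∑ j, ∫ ω, X ω j ∂(Q j)) + A) + ∫ ω, V (fun j => lam * dens ℙ Q ω j) ∂ℙ

/-- `(L^∞(ℙ))^N` -/
def Linfty {N : ℕ} (ℙ : Measure Ω) : Set (Ω → Fin N → ℝ) :=
  {Y | Measurable Y ∧ ∃ C : ℝ, ∀ᵐ ω ∂ℙ, ∀ j, |Y ω j| ≤ C}

/-- multivariate Systemic Optimal Risk Transfer Equilibrium with budget `A` -/
def IsMSORTE {N : ℕ} (ℙ : Measure Ω) (B : Set (Ω → Fin N → ℝ))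
    (U : (Fin N → ℝ) → ℝ) (X : Ω → Fin N → ℝ) (A : ℝ)
    (Y : Ω → Fin N → ℝ) (Q : Fin N → Measure Ω) (a : Fin N → ℝ) : Prop :=
  Y ∈ LSet ℙ B (UPhi U) (conj U) ∧ Q ∈ QBV ℙ B (UPhi U) (conj U) ∧
  (∑ j, a j) = A ∧
  (∀ Y' ∈ LSet ℙ B (UPhi U) (conj U), ∀ a' : Fin N → ℝ, (∑ j, a' j) = A →
    expU ℙ U (fun ω j => a' j + X ω j + Y' ω j - ∫ ω', Y' ω' j ∂(Q j)) ≤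
    expU ℙ U (fun ω j => a j + X ω j + Y ω j - ∫ ω', Y ω' j ∂(Q j))) ∧
  Y ∈ B ∧ (∀ᵐ ω ∂ℙ, (∑ j, Y ω j) = 0)


/-- A utility with infinite slope at `-∞` dominates a linear function on the losses. -/
lemma exists_sub_le_neg_apply_neg {v : ℝ → ℝ} (hmono : Monotone v) (h0 : v 0 = 0)
    (hbot : Tendsto (fun x => v x / x) atBot atTop) :
    ∃ B : ℝ, ∀ x, 0 ≤ x → x - B ≤ -v (-x) := by
  obtain ⟨a, ha⟩ := eventually_atBot.mp (hbot.eventually_ge_atTop 1)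
  refine ⟨max (-a) 1, fun x hx => ?_⟩
  rcases le_total x (max (-a) 1) with h | h
  · have := hmono (neg_nonpos.mpr hx)
    linarith
  · have h1 : 1 ≤ v (-x) / -x := ha (-x) (by linarith [le_max_left (-a) 1])
    have hx0 : -x < 0 := by linarith [le_max_right (-a) 1]
    rw [le_div_iff_of_neg hx0] at h1
    linarith [le_max_right (-a) 1]

/-- A utility with vanishing slope at `+∞` is sublinear on the gains. -/
lemma exists_le_apply_neg_max_add {v : ℝ → ℝ} (hmono : Monotone v) (h0 : v 0 = 0)
    (htop : Tendsto (fun x => v x / x) atTop (nhds 0)) {ε : ℝ} (hε : 0 < ε) :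
    ∃ B : ℝ, ∀ x, v x ≤ v (-max (-x) 0) + ε * |x| + B := by
  obtain ⟨a, ha⟩ := eventually_atTop.mp (htop.eventually_le_const hε)
  have hB : 0 ≤ v (max a 1) := h0 ▸ hmono (le_trans zero_le_one (le_max_right a 1))
  refine ⟨v (max a 1), fun x => ?_⟩
  have hεx : 0 ≤ ε * |x| := by positivity
  rcases le_total x 0 with hx | hx
  · rw [max_eq_left (neg_nonneg.mpr hx), neg_neg]
    linarith
  · rw [max_eq_right (neg_nonpos.mpr hx), neg_zero, h0]
    rcases le_total x (max a 1) with h | h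
    · linarith [hmono h]
    · have h1 : v x / x ≤ ε := ha x ((le_max_left a 1).trans h)
      have hx0 : 0 < x := by linarith [le_max_right a 1]
      rw [div_le_iff₀ hx0] at h1
      rw [abs_of_nonneg hx] at hεx ⊢
      linarith

/-- The separable function built from the losses of univariate utilities is a multivariate
Orlicz function. -/
lemma multiOrlicz_sum_neg_apply_neg {N : ℕ} {u : Fin N → ℝ → ℝ}
    (hconc : ∀ j, ConcaveOn ℝ Set.univ (u j)) (hmono : ∀ j, Monotone (u j))
    (hu0 : ∀ j, u j 0 = 0) (hbot : ∀ j, Tendsto (fun x => u j x / x) atBot atTop) :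
    MultiOrlicz (fun x : Fin N → ℝ => ∑ j, -(u j (-(x j)))) := by
  refine ⟨by simp [hu0], ⟨convex_Ici 0, ?_⟩, ?_, ?_, ?_⟩
  · intro x _ y _ a b ha hb hab
    simp only [smul_eq_mul, Finset.mul_sum, ← Finset.sum_add_distrib]
    refine Finset.sum_le_sum fun j _ => ?_
    have h := (hconc j).2 (Set.mem_univ (-x j)) (Set.mem_univ (-y j)) ha hb hab
    have harg : -((a • x + b • y) j) = a • (-x j) + b • (-y j) := by
      simp only [Pi.add_apply, Pi.smul_apply, smul_eq_mul]
      ring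
    rw [harg]
    simp only [smul_eq_mul] at h ⊢
    linarith
  · refine Continuous.continuousOn (continuous_finsetSum _ fun j _ => ?_)
    have hc : Continuous (u j) := continuousOn_univ.mp ((hconc j).continuousOn isOpen_univ)
    fun_prop
  · intro x y _ hxy
    exact Finset.sum_le_sum fun j _ => neg_le_neg (hmono j (neg_le_neg (hxy j)))
  · choose B hB using fun j => exists_sub_le_neg_apply_neg (hmono j) (hu0 j) (hbot j)
    refine ⟨1, one_pos, ∑ j, B j, fun x hx => ?_⟩
    rw [one_mul, ← Finset.sum_sub_distrib]
    exact Finset.sum_le_sum fun j _ => hB j (x j) (hx j)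

/-- A separable utility plus a bounded aggregation term is well controlled. -/
lemma exists_wellControlledBy_sum_add {N : ℕ} {u : Fin N → ℝ → ℝ}
    (hconc : ∀ j, ConcaveOn ℝ Set.univ (u j)) (hmono : ∀ j, Monotone (u j))
    (hu0 : ∀ j, u j 0 = 0) (htop : ∀ j, Tendsto (fun x => u j x / x) atTop (nhds 0))
    (hbot : ∀ j, Tendsto (fun x => u j x / x) atBot atTop)
    {Λ : (Fin N → ℝ) → ℝ} {M : ℝ} (hΛ : ∀ x, Λ x ≤ M) :
    ∃ f : ℝ → ℝ, WellControlledBy (fun x => (∑ j, u j (x j)) + Λ x)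
      (fun x => ∑ j, -(u j (-(x j)))) f := by
  have hB : ∀ ε : ℝ, ∃ B : Fin N → ℝ, 0 < ε →
      ∀ j x, u j x ≤ u j (-max (-x) 0) + ε * |x| + B j := by
    intro ε
    by_cases hε : 0 < ε
    · choose B hB using fun j => exists_le_apply_neg_max_add (hmono j) (hu0 j) (htop j) hε
      exact ⟨B, fun _ => hB⟩
    · exact ⟨0, fun h => absurd h hε⟩
  choose B hB using hB
  refine ⟨fun ε => (∑ j, B ε j) + M, multiOrlicz_sum_neg_apply_neg hconc hmono hu0 hbot, ?_⟩
  intro ε hε x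
  have h : ∑ j, u j (x j) ≤ ∑ j, (u j (-max (-x j) 0) + ε * |x j| + B ε j) :=
    Finset.sum_le_sum fun j _ => hB ε hε j (x j)
  simp only [Finset.sum_add_distrib, ← Finset.mul_sum] at h
  simp only [negPart, Finset.sum_neg_distrib, neg_neg]
  linarith [hΛ x]

/-- Finite-dimensional Jensen inequality with uniform weights. -/
lemma sum_inv_mul_le_map_sum {N : ℕ} (hN : N ≠ 0) {g : ℝ → ℝ} (hg : ConcaveOn ℝ Set.univ g)
    (z : Fin N → ℝ) : ∑ j, (N : ℝ)⁻¹ * g (N * z j) ≤ g (∑ j, z j) := by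
  have hN' : (N : ℝ) ≠ 0 := Nat.cast_ne_zero.mpr hN
  have h := hg.le_map_sum (t := Finset.univ) (w := fun _ : Fin N => (N : ℝ)⁻¹)
    (p := fun j => N * z j) (fun _ _ => by positivity) (by simp [hN']) (fun _ _ => Set.mem_univ _)
  simpa only [smul_eq_mul, inv_mul_cancel_left₀ hN'] using h

/-- Up to a rescaling of the argument, the Orlicz function of the aggregated utility is dominated
by an affine function of the separable one. -/
lemma exists_uPhi_smul_le {N K : ℕ} (hN : N ≠ 0) {u : Fin N → ℝ → ℝ}
    (hmono : ∀ j, Monotone (u j)) (hu0 : ∀ j, u j 0 = 0)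
    {Λk : Fin K → ℝ → ℝ} {β : Fin K → Fin N → ℝ} (hβ : ∀ k j, 0 ≤ β k j)
    (hΛkconc : ∀ k, ConcaveOn ℝ Set.univ (Λk k))
    (hprec : ∀ j k, ∃ κ : ℝ, ∃ c ≥ (0:ℝ), ∃ C ≥ (0:ℝ),
      ∀ x ≤ (0:ℝ), C * u j (c * x) + κ ≤ Λk k x) :
    ∃ s > (0:ℝ), ∃ D E : ℝ, ∀ y : Fin N → ℝ, 0 ≤ y →
      UPhi (fun x => (∑ j, u j (x j)) + ∑ k, Λk k (∑ j, β k j * x j)) (s • y) ≤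
        D * (∑ j, -(u j (-(y j)))) + E := by
  choose κ c hc C hC hprec using hprec
  set T : ℝ := ∑ j, ∑ k, c j k * (N * β k j)
  have hterm : ∀ j k, 0 ≤ c j k * (N * β k j) := fun j k =>
    mul_nonneg (hc j k) (mul_nonneg (Nat.cast_nonneg N) (hβ k j))
  have hT0 : 0 ≤ T := Finset.sum_nonneg fun j _ => Finset.sum_nonneg fun k _ => hterm j k
  have hle : ∀ j k, c j k * (N * β k j) ≤ T := fun j k =>
    (Finset.single_le_sum (f := fun k => c j k * (N * β k j)) (fun k _ => hterm j k)
      (Finset.mem_univ k)).trans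
    (Finset.single_le_sum (f := fun j => ∑ k, c j k * (N * β k j))
      (fun j _ => Finset.sum_nonneg fun k _ => hterm j k) (Finset.mem_univ j))
  set s : ℝ := (1 + T)⁻¹
  have hs0 : 0 < s := by positivity
  have hsT : (1 + T) * s = 1 := mul_inv_cancel₀ (by positivity)
  have hs1 : s ≤ 1 := by nlinarith [mul_nonneg hT0 hs0.le]
  refine ⟨s, hs0, 1 + ∑ k, ∑ j, (N : ℝ)⁻¹ * C j k,
    ∑ k, (Λk k 0 - ∑ j, (N : ℝ)⁻¹ * κ j k), fun y hy => ?_⟩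
  set P : ℝ := ∑ j, -(u j (-(y j)))
  have hu_nonneg : ∀ j, 0 ≤ -(u j (-(y j))) := fun j =>
    neg_nonneg.mpr (hu0 j ▸ hmono j (neg_nonpos.mpr (hy j)))
  have hu_le : ∀ j, -(u j (-(y j))) ≤ P := fun j =>
    Finset.single_le_sum (f := fun j => -(u j (-(y j)))) (fun j _ => hu_nonneg j)
      (Finset.mem_univ j)
  have hsmall : ∑ j, -(u j (-(s * y j))) ≤ P := by
    refine Finset.sum_le_sum fun j _ => neg_le_neg (hmono j ?_)
    exact neg_le_neg (mul_le_of_le_one_left (hy j) hs1)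
  have hagg : ∀ k, -Λk k (∑ j, β k j * -(s * y j)) ≤
      (∑ j, (N : ℝ)⁻¹ * C j k) * P - ∑ j, (N : ℝ)⁻¹ * κ j k := by
    intro k
    have hJ := sum_inv_mul_le_map_sum hN (hΛkconc k) (fun j => β k j * -(s * y j))
    have hsum : ∑ j, (N : ℝ)⁻¹ * (κ j k - C j k * P) ≤
        ∑ j, (N : ℝ)⁻¹ * Λk k (N * (β k j * -(s * y j))) := by
      refine Finset.sum_le_sum fun j _ => mul_le_mul_of_nonneg_left ?_ (by positivity)
      have hyj : 0 ≤ y j := hy j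
      have hβj := hβ k j
      have harg : 0 ≤ N * (β k j * (s * y j)) := by positivity
      refine le_trans ?_ (hprec j k (N * (β k j * -(s * y j))) (by linarith))
      have hcs : c j k * (N * β k j) * s ≤ 1 := by
        nlinarith [mul_le_mul_of_nonneg_right (hle j k) hs0.le]
      have hu := hmono j (show -(y j) ≤ c j k * (N * (β k j * -(s * y j))) by
        nlinarith [mul_le_mul_of_nonneg_right hcs hyj])
      nlinarith [mul_le_mul_of_nonneg_left ((neg_le_neg hu).trans (hu_le j)) (hC j k)]
    simp only [mul_sub, Finset.sum_sub_distrib, ← mul_assoc, ← Finset.sum_mul] at hsum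
    simp only [← mul_assoc] at hJ ⊢
    linarith
  have hagg_sum := Finset.sum_le_sum fun k (_ : k ∈ Finset.univ) => hagg k
  simp only [Finset.sum_sub_distrib, ← Finset.sum_mul, Finset.sum_neg_distrib] at hagg_sum hsmall
  simp only [UPhi, Pi.zero_apply, Pi.neg_apply, Pi.smul_apply, smul_eq_mul, hu0, mul_zero,
    Finset.sum_const_zero, Finset.sum_sub_distrib]
  linarith

/-- The separable Orlicz function is dominated by the one of the aggregated utility. -/
lemma sum_neg_apply_neg_le_uPhi {N K : ℕ} {u : Fin N → ℝ → ℝ} (hu0 : ∀ j, u j 0 = 0)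
    {Λk : Fin K → ℝ → ℝ} {β : Fin K → Fin N → ℝ} (hβ : ∀ k j, 0 ≤ β k j)
    (hΛkmono : ∀ k, Monotone (Λk k)) {y : Fin N → ℝ} (hy : 0 ≤ y) :
    ∑ j, -(u j (-(y j))) ≤
      UPhi (fun x => (∑ j, u j (x j)) + ∑ k, Λk k (∑ j, β k j * x j)) y := by
  have h : ∑ k, Λk k (∑ j, β k j * -y j) ≤ ∑ k, Λk k 0 := by
    refine Finset.sum_le_sum fun k _ => hΛkmono k (Finset.sum_nonpos fun j _ => ?_)
    exact mul_nonpos_of_nonneg_of_nonpos (hβ k j) (neg_nonpos.mpr (hy j))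
  simp only [UPhi, Pi.zero_apply, Pi.neg_apply, hu0, mul_zero, Finset.sum_const_zero,
    Finset.sum_neg_distrib]
  linarith

/-- Two nonnegative functions that dominate each other, up to rescaling and affine terms, define
the same Orlicz space. -/
lemma lspace_eq_of_le_of_smul_le {Ω : Type*} [MeasurableSpace Ω] (ℙ : Measure Ω)
    [IsFiniteMeasure ℙ] {N : ℕ} {Φ Ψ : (Fin N → ℝ) → ℝ} (hΦ : Measurable Φ) (hΨ : Measurable Ψ)
    (hΨ0 : ∀ y, 0 ≤ y → 0 ≤ Ψ y) (hle : ∀ y, 0 ≤ y → Ψ y ≤ Φ y)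
    {s D E : ℝ} (hs : 0 < s) (hsmul : ∀ y, 0 ≤ y → Φ (s • y) ≤ D * Ψ y + E) :
    Lspace ℙ Φ = Lspace ℙ Ψ := by
  have hmeas : ∀ {X : Ω → Fin N → ℝ}, Measurable X → ∀ r : ℝ,
      Measurable fun ω j => r * |X ω j| := fun hX r =>
    measurable_pi_lambda _ fun j => ((measurable_pi_apply j).comp hX).abs.const_mul r
  ext X
  constructor
  · rintro ⟨hX, r, hr, hInt⟩
    refine ⟨hX, r, hr, hInt.mono' (hΨ.comp (hmeas hX r)).aestronglyMeasurable ?_⟩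
    refine Eventually.of_forall fun ω => ?_
    have hy : (0 : Fin N → ℝ) ≤ fun j => r * |X ω j| := fun j => by positivity
    rw [Real.norm_of_nonneg (hΨ0 _ hy)]
    exact hle _ hy
  · rintro ⟨hX, r, hr, hInt⟩
    refine ⟨hX, s * r, mul_pos hs hr, Integrable.mono' ((hInt.const_mul D).add
      (integrable_const E)) (hΦ.comp (hmeas hX (s * r))).aestronglyMeasurable ?_⟩
    refine Eventually.of_forall fun ω => ?_
    have hy : (0 : Fin N → ℝ) ≤ fun j => r * |X ω j| := fun j => by positivity
    have hy' : (0 : Fin N → ℝ) ≤ fun j => s * r * |X ω j| := fun j => by positivity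
    rw [Real.norm_of_nonneg ((hΨ0 _ hy').trans (hle _ hy'))]
    have h := hsmul _ hy
    have harg : (s • fun j => r * |X ω j|) = fun j => s * r * |X ω j| := by
      ext j
      simp [mul_assoc]
    rw [harg] at h
    exact h

/-- Proposition 7.3: if `Λ` is an aggregation of the form `∑ₖ Λᵏ(∑ⱼ βᵏⱼ xʲ)` with
`uⱼ ⪯ Λᵏ`, then `L^Φ = L^{Φ̂}` and Standing Assumption I holds (Statement 14). -/
theorem standing_assumption_I_holds
    {Ω : Type*} [MeasurableSpace Ω] (ℙ : Measure Ω) [IsProbabilityMeasure ℙ]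
    {N : ℕ} (hN : 1 ≤ N)
    (u : Fin N → ℝ → ℝ)
    (huconc : ∀ j, StrictConcaveOn ℝ Set.univ (u j))
    (humono : ∀ j, StrictMono (u j))
    (hu0 : ∀ j, u j 0 = 0)
    (hInadaTop : ∀ j, Tendsto (fun x => u j x / x) atTop (nhds 0))
    (hInadaBot : ∀ j, Tendsto (fun x => u j x / x) atBot atTop)
    {K : ℕ} (hK : 1 ≤ K)
    (Λk : Fin K → ℝ → ℝ)
    (β : Fin K → Fin N → ℝ)
    (hβ : ∀ k j, 0 ≤ β k j)
    (hβpos : ∃ k j, 0 < β k j)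
    (hΛkconc : ∀ k, ConcaveOn ℝ Set.univ (Λk k))
    (hΛkmono : ∀ k, Monotone (Λk k))
    (hΛkbdd : ∀ k, BddAbove (Set.range (Λk k)))
    (hprec : ∀ j k, ∃ κ : ℝ, ∃ c ≥ (0:ℝ), ∃ C ≥ (0:ℝ),
      ∀ x ≤ (0:ℝ), C * u j (c * x) + κ ≤ Λk k x) :
    let Λ : (Fin N → ℝ) → ℝ := fun x => ∑ k, Λk k (∑ j, β k j * x j)
    let U : (Fin N → ℝ) → ℝ := fun x => (∑ j, u j (x j)) + Λ x
    let Φh : (Fin N → ℝ) → ℝ := fun x => ∑ j, -(u j (-(x j)))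
    Lspace ℙ (UPhi U) = Lspace ℙ Φh ∧
    (∃ f : ℝ → ℝ, WellControlledBy U Φh f) := by
  intro Λ U Φh
  have hmono : ∀ j, Monotone (u j) := fun j => (humono j).monotone
  constructor
  · obtain ⟨s, hs, D, E, hsmul⟩ :=
      exists_uPhi_smul_le (Nat.one_le_iff_ne_zero.mp hN) hmono hu0 hβ hΛkconc hprec
    have hum : ∀ j, Measurable (u j) := fun j => (hmono j).measurable
    have hΛm : ∀ k, Measurable (Λk k) := fun k => (hΛkmono k).measurable
    have hU : Measurable U := by fun_prop
    have hΦU : Measurable (UPhi U) := by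
      unfold UPhi
      fun_prop
    have hΦh : Measurable Φh := by fun_prop
    refine lspace_eq_of_le_of_smul_le ℙ hΦU hΦh (fun y hy => ?_)
      (fun y hy => sum_neg_apply_neg_le_uPhi hu0 hβ hΛkmono hy) hs hsmul
    exact Finset.sum_nonneg fun j _ =>
      neg_nonneg.mpr (hu0 j ▸ hmono j (neg_nonpos.mpr (hy j)))
  · choose M hM using hΛkbdd
    exact exists_wellControlledBy_sum_add (fun j => (huconc j).concaveOn) hmono hu0
      hInadaTop hInadaBot (M := ∑ k, M k)
      (fun x => Finset.sum_le_sum fun k _ => hM k ⟨_, rfl⟩)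

end MSORTE
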